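/- Let P be a polyhedron in E with defining data (ι, n, b), let f : E → ℝ be convex (ConvexOn ℝ Set.univ f) with argmin_P f nonempty, and let A and B be affine spaces of P with A ⊊ B. Suppose argmin_{P_A} f is nonempty and B disqualifies A, i.e., B = ⋂{∂H i | A ⊆ ∂H i and argmin_{P_A} f ⊆ ∂H i} (B is the min space of f on P_A). Then A is not the min space of f on P, i.e., A ≠ ⋂{∂H i | argmin_P f ⊆ ∂H i}. -/

import Mathlib

open RealInnerProductSpace

/-- A nonempty convex subset of a polyhedron contains a point at which every inequality that is not
an equality on the whole subset is strict. -/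
theorem Convex.exists_mem_forall_inner_lt
    {E : Type*} [NormedAddCommGroup E] [InnerProductSpace ℝ E] {ι : Type*} [Finite ι]
    {n : ι → E} {b : ι → ℝ} {M : Set E} (hconv : Convex ℝ M) (hne : M.Nonempty)
    (hle : ∀ x ∈ M, ∀ i, ⟪x, n i⟫ ≤ b i) :
    ∃ x ∈ M, ∀ i, ¬ M ⊆ {w : E | ⟪w, n i⟫ = b i} → ⟪x, n i⟫ < b i := by
  classical
  have := Fintype.ofFinite ι
  suffices h : ∀ s : Finset ι,
      ∃ x ∈ M, ∀ i ∈ s, ¬ M ⊆ {w : E | ⟪w, n i⟫ = b i} → ⟪x, n i⟫ < b i by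
    simpa using h Finset.univ
  intro s
  induction s using Finset.induction_on with
  | empty => simpa [Set.Nonempty] using hne
  | insert j s _ ih =>
    obtain ⟨x, hxM, hx⟩ := ih
    by_cases hj : M ⊆ {w : E | ⟪w, n j⟫ = b j}
    · refine ⟨x, hxM, fun i hi hiM => ?_⟩
      rcases Finset.mem_insert.mp hi with rfl | hi
      · exact absurd hj hiM
      · exact hx i hi hiM
    · obtain ⟨y, hyM, hy⟩ := Set.not_subset.mp hj
      refine ⟨(1 / 2 : ℝ) • x + (1 / 2 : ℝ) • y,
        hconv hxM hyM (by norm_num) (by norm_num) (by norm_num), fun i hi hiM => ?_⟩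
      rw [inner_add_left, real_inner_smul_left, real_inner_smul_left]
      rcases Finset.mem_insert.mp hi with rfl | hi
      · have := lt_of_le_of_ne (hle y hyM i) hy
        linarith [hle x hxM i]
      · linarith [hx i hi hiM, hle y hyM i]

theorem disqualified_not_min_space
    {E : Type*} [NormedAddCommGroup E] [InnerProductSpace ℝ E] [FiniteDimensional ℝ E]
    {ι : Type*} [Fintype ι] (n : ι → E) (b : ι → ℝ)
    (f : E → ℝ) (hf : ConvexOn ℝ Set.univ f)
    (P : Set E) (hP : P = {x : E | ∀ i, ⟪x, n i⟫ ≤ b i})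
    (M : Set E) (hM : M = {x ∈ P | ∀ y ∈ P, f x ≤ f y}) (hMne : M.Nonempty)
    (A B : Set E)
    (hAaff : ∃ s : Set ι, A = ⋂ i ∈ s, {x : E | ⟪x, n i⟫ = b i}) (hAne : A.Nonempty)
    (hBaff : ∃ s : Set ι, B = ⋂ i ∈ s, {x : E | ⟪x, n i⟫ = b i}) (hBne : B.Nonempty)
    (hAB : A ⊂ B)
    (PA : Set E)
    (hPA : PA = {x : E | ∀ i, A ⊆ {w : E | ⟪w, n i⟫ = b i} → ⟪x, n i⟫ ≤ b i})
    (MA : Set E) (hMA : MA = {x ∈ PA | ∀ y ∈ PA, f x ≤ f y}) (hMAne : MA.Nonempty)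
    (hdisq : B = ⋂ i ∈ {j : ι | A ⊆ {x : E | ⟪x, n j⟫ = b j} ∧
        MA ⊆ {x : E | ⟪x, n j⟫ = b j}}, {x : E | ⟪x, n i⟫ = b i}) :
    A ≠ ⋂ i ∈ {j : ι | M ⊆ {x : E | ⟪x, n j⟫ = b j}}, {x : E | ⟪x, n i⟫ = b i} := by
  intro hA
  have hMP : ∀ x ∈ M, ∀ i, ⟪x, n i⟫ ≤ b i := by
    intro x hx
    rw [hM, hP] at hx
    exact hx.1
  have hMmin : ∀ x ∈ M, ∀ y, (∀ i, ⟪y, n i⟫ ≤ b i) → f x ≤ f y := by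
    intro x hx y hy
    rw [hM, hP] at hx
    exact hx.2 y hy
  have hmemM : ∀ x ∈ M, ∀ z, (∀ i, ⟪z, n i⟫ ≤ b i) → f z ≤ f x → z ∈ M := by
    intro x hx z hz hzx
    rw [hM, hP]
    exact ⟨hz, fun y hy => hzx.trans (hMmin x hx y hy)⟩
  have hMconv : Convex ℝ M := by
    intro x hx y hy s t hs ht hst
    refine hmemM x hx _ (fun i => ?_) ?_
    · rw [inner_add_left, real_inner_smul_left, real_inner_smul_left]
      calc s * ⟪x, n i⟫ + t * ⟪y, n i⟫ ≤ s * b i + t * b i := by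
            gcongr <;> exact hMP _ ‹_› i
        _ = b i := by rw [← add_mul, hst, one_mul]
    · calc f (s • x + t • y) ≤ s * f x + t * f y := by
            simpa using hf.2 (Set.mem_univ x) (Set.mem_univ y) hs ht hst
        _ ≤ s * f x + t * f x := by
            gcongr
            exact hMmin y hy x (hMP x hx)
        _ = f x := by rw [← add_mul, hst, one_mul]
  have hAM : ∀ i, M ⊆ {x : E | ⟪x, n i⟫ = b i} → A ⊆ {x : E | ⟪x, n i⟫ = b i} := by
    intro i hi
    rw [hA]
    exact Set.biInter_subset_of_mem (show i ∈ {j : ι | M ⊆ {x : E | ⟪x, n j⟫ = b j}} from hi)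
  obtain ⟨x, hxM, hx⟩ := hMconv.exists_mem_forall_inner_lt hMne hMP
  obtain ⟨j, hj, y, hyMA, hyj⟩ : ∃ j, M ⊆ {x : E | ⟪x, n j⟫ = b j} ∧
      ∃ y ∈ MA, ⟪y, n j⟫ ≠ b j := by
    by_contra! h
    refine hAB.2 fun z hz => ?_
    rw [hA]
    rw [hdisq] at hz
    exact Set.mem_iInter₂.mpr fun i hi =>
      Set.mem_iInter₂.mp hz i ⟨hAM i hi, fun y hy => h i hi y hy⟩
  rw [hMA, hPA] at hyMA
  obtain ⟨hyP, hymin⟩ := hyMA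
  have hyx : f y ≤ f x := hymin x fun i _ => hMP x hxM i
  have hlim : ∀ᶠ t in nhdsWithin (0 : ℝ) (Set.Ioi 0), ∀ i,
      ⟪x, n i⟫ < b i → (1 - t) * ⟪x, n i⟫ + t * ⟪y, n i⟫ < b i := by
    rw [Filter.eventually_all]
    intro i
    rw [Filter.eventually_imp_distrib_left]
    intro hi
    have hc : ContinuousAt (fun t : ℝ => (1 - t) * ⟪x, n i⟫ + t * ⟪y, n i⟫) 0 := by fun_prop
    exact nhdsWithin_le_nhds (hc.tendsto.eventually_lt_const (by simpa using hi))
  obtain ⟨t, ht, ht0, ht1⟩ := (hlim.and (Ioo_mem_nhdsGT (zero_lt_one' ℝ))).exists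
  have hinner : ∀ i, ⟪(1 - t) • x + t • y, n i⟫ = (1 - t) * ⟪x, n i⟫ + t * ⟪y, n i⟫ := by
    intro i
    rw [inner_add_left, real_inner_smul_left, real_inner_smul_left]
  have hzM : (1 - t) • x + t • y ∈ M := by
    refine hmemM x hxM _ (fun i => ?_) ?_
    · rw [hinner]
      by_cases hi : M ⊆ {w : E | ⟪w, n i⟫ = b i}
      · nlinarith [hMP x hxM i, hyP i (hAM i hi)]
      · exact (ht i (hx i hi)).le
    · have := hf.2 (Set.mem_univ x) (Set.mem_univ y) (sub_nonneg.mpr ht1.le) ht0.le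
        (sub_add_cancel 1 t)
      simp only [smul_eq_mul] at this
      nlinarith
  have hzj : ⟪(1 - t) • x + t • y, n j⟫ = b j := hj hzM
  have hxj : ⟪x, n j⟫ = b j := hj hxM
  rw [hinner, hxj] at hzj
  refine hyj (mul_left_cancel₀ ht0.ne' ?_)
  linarith
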